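/- Let (M, 𝓕, p) be a probability space, {U_k}_{k=1}^{L} a finite measurable cover of M, and {U'_{k'}}_{k'=1}^{L'} a refined partition of the cover with n(k') := #{k : U'_{k'} ⊆ U_k} and ν(k') := p(U'_{k'}), and suppose ν(k') > 0 for every k'. Let p^{U'}_{k'} be the conditional probability measure A ↦ p(A ∩ U'_{k'})/ν(k'). Then for every k, the partition-based measure Σ_{k' : U'_{k'} ⊆ U_k} (ν(k')/n(k')) · p^{U'}_{k'} equals the measure μ_k with density 1_{U_k}(x)/n(x) with respect to p, where n(x) := #{k : x ∈ U_k}; in particular the density of this measure with respect to p at a point x in the overlap of several cover elements is inversely proportional to the number n(x) of cover elements containing x. -/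

import Mathlib

open MeasureTheory ProbabilityTheory
open scoped ENNReal Classical

/-- For a finite measurable cover `{U k}` with refined partition `{U' k'}` (each
partition element having positive measure), the partition-based measure
`∑_{k' : U' k' ⊆ U k} (ν k' / n k') • p[|U' k']` equals the measure with density
`1_{U k}(x) / nₓ x` with respect to `p`, where `nₓ x` is the number of cover
elements containing `x`. -/
theorem stmt_4 {M : Type*} [MeasurableSpace M] (p : Measure M) [IsProbabilityMeasure p]
    (L L' : ℕ) (U : Fin L → Set M) (U' : Fin L' → Set M)
    (hUmeas : ∀ k, MeasurableSet (U k))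
    (hUcover : ⋃ k, U k = Set.univ)
    (hU'meas : ∀ k', MeasurableSet (U' k'))
    (hU'disj : Pairwise (Function.onFun Disjoint U'))
    (hU'cover : ⋃ k', U' k' = Set.univ)
    (hrefine : ∀ k' k, U' k' ⊆ U k ∨ U' k' ∩ U k = ∅)
    (hsub : ∀ k', ∃ k, U' k' ⊆ U k)
    (n : Fin L' → ℕ) (hn : ∀ k', n k' = (Finset.univ.filter (fun k => U' k' ⊆ U k)).card)
    (ν : Fin L' → ℝ≥0∞) (hν : ∀ k', ν k' = p (U' k'))
    (hνpos : ∀ k', 0 < ν k')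
    (nx : M → ℕ) (hnx : ∀ x, nx x = (Finset.univ.filter (fun k => x ∈ U k)).card) :
    ∀ k, (∑ k' ∈ Finset.univ.filter (fun k' => U' k' ⊆ U k),
        (ν k' / (n k' : ℝ≥0∞)) • p[|U' k'])
      = p.withDensity ((U k).indicator (fun x => ((nx x : ℝ≥0∞))⁻¹)) := by
  intro k
  have mem_iff {k' x} (hx : x ∈ U' k') (j) : x ∈ U j ↔ U' k' ⊆ U j := by
    refine ⟨fun hj => (hrefine k' j).resolve_right fun h => ?_, fun h => h hx⟩
    exact (Set.eq_empty_iff_forall_notMem.mp h x) ⟨hx, hj⟩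
  have nx_eq {k' x} (hx : x ∈ U' k') : nx x = n k' := by
    simp only [hnx, hn, mem_iff hx]
  have hU : U k = ⋃ k' ∈ Finset.univ.filter (fun k' => U' k' ⊆ U k), U' k' := by
    ext x
    simp only [Finset.mem_filter, Finset.mem_univ, true_and, Set.mem_iUnion, exists_prop]
    refine ⟨fun hx => ?_, fun ⟨k', h, hx⟩ => h hx⟩
    obtain ⟨k', hk'⟩ := Set.mem_iUnion.mp (hU'cover ▸ Set.mem_univ x)
    exact ⟨k', (mem_iff hk' k).mp hx, hk'⟩
  ext s hs
  rw [withDensity_apply _ hs, setLIntegral_indicator (hUmeas k), Set.inter_comm]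
  conv_rhs => rw [hU]
  rw [Set.inter_iUnion₂, lintegral_biUnion_finset
    (fun i _ j _ hij => (hU'disj hij).mono Set.inter_subset_right Set.inter_subset_right)
    (fun i _ => hs.inter (hU'meas i)), Measure.finsetSum_apply]
  refine Finset.sum_congr rfl fun k' _ => ?_
  rw [setLIntegral_congr_fun (g := fun _ => (n k' : ℝ≥0∞)⁻¹) (hs.inter (hU'meas k'))
    (fun x hx => by simp only [nx_eq hx.2]), setLIntegral_const, Measure.smul_apply,
    cond_apply (hU'meas k'), smul_eq_mul, ← hν, Set.inter_comm, div_eq_mul_inv,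
    mul_comm (ν k'), mul_assoc, ← mul_assoc (ν k'),
    ENNReal.mul_inv_cancel (hνpos k').ne' (hν k' ▸ measure_ne_top p _), one_mul]
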